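/- Correctness of the reweighted LP decoding algorithm (precise finite form of the theorem that reweighting improves the provable thresholds): Let E ⊆ {1,…,n} be the set of flipped bits (received word x^r = 1_E, transmitted codeword all-zero), let E₁ ⊆ E, and let C > 1 be such that: (a) FCP(E₁, C) holds for H; (b) for every set A ⊆ {1,…,n} with |A| ≤ |E₁| there exists a feasible dual set for the vector γ^A defined by γ^A_i = −1 for i ∈ A and γ^A_i = 1 for i ∉ A; and (c) 4·((C+1)/(C−1))·(|E| − |E₁|) ≤ |E₁|. Let x^p ∈ K(H) satisfy ‖x^p − x^r‖₁ ≤ ‖x^r‖₁, and let L ⊆ {1,…,n} with |L| = |E| satisfy |x^r_i − x^p_i| ≥ |x^r_{i'} − x^p_{i'}| for all i ∈ L and i' ∉ L. Then every nonzero x ∈ P(H) satisfies −‖(x − x^r)_L‖₁ + ‖(x − x^r)_{L^c}‖₁ > −‖(x^r)_L‖₁ + ‖(x^r)_{L^c}‖₁; that is, the reweighted LP step (with weights λ₁ = −1, λ₂ = 1) recovers the transmitted all-zero codeword as its unique optimum. -/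

import Mathlib

open Finset

/-- The fundamental cone `K(H)` of a binary parity-check matrix `H`. -/
def fundCone {m n : ℕ} (H : Fin m → Fin n → Bool) : Set (Fin n → ℝ) :=
  {ω | (∀ i, 0 ≤ ω i) ∧
    ∀ j : Fin m, ∀ i, H j i = true →
      ω i ≤ ∑ i' ∈ (Finset.univ.filter fun i' => H j i' = true).erase i, ω i'}

/-- The fundamental cone property `FCP(S, C)`. -/
def FCP {m n : ℕ} (H : Fin m → Fin n → Bool) (S : Finset (Fin n)) (C : ℝ) : Prop :=
  ∀ ω ∈ fundCone H, ω ≠ 0 → C * ∑ i ∈ S, |ω i| < ∑ i ∈ Sᶜ, |ω i|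

/-- The local codeword set `C_j` of check `j`. -/
def localCodewords {m n : ℕ} (H : Fin m → Fin n → Bool) (j : Fin m) :
    Set (Fin n → ℝ) :=
  {x | ∃ b : Fin n → Bool, x = (fun i => if b i then (1 : ℝ) else 0) ∧
    Even ((Finset.univ.filter fun i => H j i = true ∧ b i = true).card)}

/-- The fundamental polytope `P(H)`. -/
def fundPolytope {m n : ℕ} (H : Fin m → Fin n → Bool) : Set (Fin n → ℝ) :=
  ⋂ j : Fin m, convexHull ℝ (localCodewords H j)

/-- A feasible dual set of variables `τ` for the log-likelihood vector `γ`. -/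
def feasibleDual {m n : ℕ} (H : Fin m → Fin n → Bool) (γ : Fin n → ℝ)
    (τ : Fin n → Fin m → ℝ) : Prop :=
  (∀ j : Fin m, ∀ i, H j i = true → ∀ i', H j i' = true → i ≠ i' →
      0 ≤ τ i j + τ i' j) ∧
  (∀ i, ∑ j ∈ Finset.univ.filter (fun j => H j i = true), τ i j < γ i)

/-- The indicator vector of a set `E` of bit positions. -/
def indic {n : ℕ} (E : Finset (Fin n)) : Fin n → ℝ := fun i => if i ∈ E then 1 else 0

/-- Points of the convex hull of a local code lie in the unit cube and satisfy the cone
inequalities of that check. -/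
lemma convexHull_localCodewords_subset {m n : ℕ} (H : Fin m → Fin n → Bool) (j : Fin m) :
    convexHull ℝ (localCodewords H j) ⊆ {x | (∀ i, 0 ≤ x i ∧ x i ≤ 1) ∧
      ∀ i, H j i = true →
        x i ≤ ∑ i' ∈ (Finset.univ.filter fun i' => H j i' = true).erase i, x i'} := by
  apply convexHull_min
  · rintro x ⟨b, rfl, hb⟩
    refine ⟨fun i => by dsimp only; split_ifs <;> norm_num, fun i hi => ?_⟩
    have hnonneg : ∀ i' ∈ (Finset.univ.filter fun i' => H j i' = true).erase i,
        (0 : ℝ) ≤ if b i' then 1 else 0 := fun i' _ => by split_ifs <;> norm_num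
    by_cases hbi : b i = true
    · obtain ⟨i', hi', hne⟩ : ∃ i' ∈ Finset.univ.filter fun i => H j i = true ∧ b i = true,
          i' ≠ i := by
        apply Finset.exists_mem_ne
        have hpos : 0 < (Finset.univ.filter fun i => H j i = true ∧ b i = true).card :=
          Finset.card_pos.2 ⟨i, by simp [hi, hbi]⟩
        obtain ⟨r, hr⟩ := hb
        omega
      simp only [Finset.mem_filter, Finset.mem_univ, true_and] at hi'
      have h := Finset.single_le_sum hnonneg
        (show i' ∈ (Finset.univ.filter fun i' => H j i' = true).erase i by simp [hne, hi'.1])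
      simpa [hbi, hi'.2] using h
    · simp [hbi]
  · rintro x ⟨hx, hx'⟩ y ⟨hy, hy'⟩ a b ha hb hab
    refine ⟨fun i => ?_, fun i hi => ?_⟩
    · simp only [Pi.add_apply, Pi.smul_apply, smul_eq_mul]
      have h1 := mul_nonneg ha (hx i).1
      have h2 := mul_nonneg hb (hy i).1
      have h3 := mul_le_mul_of_nonneg_left (hx i).2 ha
      have h4 := mul_le_mul_of_nonneg_left (hy i).2 hb
      constructor <;> linarith
    · simp only [Pi.add_apply, Pi.smul_apply, smul_eq_mul, Finset.sum_add_distrib,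
        ← Finset.mul_sum]
      exact add_le_add (mul_le_mul_of_nonneg_left (hx' i hi) ha)
        (mul_le_mul_of_nonneg_left (hy' i hi) hb)

/-- Weights with nonnegative pairwise sums have a nonnegative pairing with nonnegative vectors
in which no coordinate exceeds the sum of the others. -/
lemma sum_mul_nonneg_of_pairwise {ι : Type*} [DecidableEq ι] (s : Finset ι) (t x : ι → ℝ)
    (ht : ∀ i ∈ s, ∀ i' ∈ s, i ≠ i' → 0 ≤ t i + t i') (hx : ∀ i ∈ s, 0 ≤ x i)
    (hxs : ∀ i ∈ s, x i ≤ ∑ i' ∈ s.erase i, x i') : 0 ≤ ∑ i ∈ s, t i * x i := by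
  by_cases h : ∀ i ∈ s, 0 ≤ t i
  · exact Finset.sum_nonneg fun i hi => mul_nonneg (h i hi) (hx i hi)
  push Not at h
  obtain ⟨i, hi, hti⟩ := h
  rw [← Finset.add_sum_erase s _ hi]
  have h1 : -t i * ∑ i' ∈ s.erase i, x i' ≤ ∑ i' ∈ s.erase i, t i' * x i' := by
    rw [Finset.mul_sum]
    refine Finset.sum_le_sum fun i' hi' => ?_
    obtain ⟨hne, hi's⟩ := Finset.mem_erase.1 hi'
    exact mul_le_mul_of_nonneg_right (by linarith [ht i hi i' hi's hne.symm]) (hx i' hi's)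
  nlinarith [hxs i hi]

/-- A feasible dual set certifies positivity of the objective on the fundamental cone. -/
lemma feasibleDual.sum_pos {m n : ℕ} {H : Fin m → Fin n → Bool} {γ : Fin n → ℝ}
    {τ : Fin n → Fin m → ℝ} (hτ : feasibleDual H γ τ) {x : Fin n → ℝ}
    (hx : x ∈ fundCone H) (hne : x ≠ 0) : 0 < ∑ i, γ i * x i := by
  obtain ⟨k, hk⟩ := Function.ne_iff.1 hne
  have hk : 0 < x k := lt_of_le_of_ne (hx.1 k) (Ne.symm hk)
  have hlt : ∑ i, (∑ j ∈ Finset.univ.filter (fun j => H j i = true), τ i j) * x i <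
      ∑ i, γ i * x i :=
    Finset.sum_lt_sum (fun i _ => mul_le_mul_of_nonneg_right (hτ.2 i).le (hx.1 i))
      ⟨k, Finset.mem_univ k, mul_lt_mul_of_pos_right (hτ.2 k) hk⟩
  refine lt_of_le_of_lt ?_ hlt
  have hswap : ∑ i, (∑ j ∈ Finset.univ.filter (fun j => H j i = true), τ i j) * x i =
      ∑ j, ∑ i ∈ Finset.univ.filter (fun i => H j i = true), τ i j * x i := by
    simp_rw [Finset.sum_mul, Finset.sum_filter]
    exact Finset.sum_comm
  rw [hswap]
  refine Finset.sum_nonneg fun j _ => sum_mul_nonneg_of_pairwise _ _ _ ?_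
    (fun i _ => hx.1 i) ?_
  · simpa only [Finset.mem_filter, Finset.mem_univ, true_and] using hτ.1 j
  · simpa only [Finset.mem_filter, Finset.mem_univ, true_and] using hx.2 j

/-- Robustness of the fundamental cone property: a cone vector at least as close to `1_E` as
the origin has small `ℓ¹` norm. -/
lemma FCP.sum_le {m n : ℕ} {H : Fin m → Fin n → Bool} {E E₁ : Finset (Fin n)} (hE₁ : E₁ ⊆ E)
    {C : ℝ} (hC : 1 < C) (hFCP : FCP H E₁ C) {ω : Fin n → ℝ} (hω : ω ∈ fundCone H)
    (hobj : ∑ i, |ω i - indic E i| ≤ ∑ i, |indic E i|) :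
    ∑ i, ω i ≤ 2 * ((C + 1) / (C - 1)) * ((E.card : ℝ) - E₁.card) := by
  have hcard : ((E \ E₁).card : ℝ) = E.card - E₁.card := by
    rw [Finset.card_sdiff_of_subset hE₁, Nat.cast_sub (Finset.card_le_card hE₁)]
  have hfcp : C * ∑ i ∈ E₁, ω i ≤ ∑ i ∈ E₁ᶜ, ω i := by
    by_cases h0 : ω = 0
    · simp [h0]
    · have h := (hFCP ω hω h0).le
      simpa only [abs_of_nonneg (hω.1 _)] using h
  have hpt : ∑ i, ((if i ∈ E₁ then -ω i else ω i) - if i ∈ E \ E₁ then (2 : ℝ) else 0) ≤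
      ∑ i, (|ω i - indic E i| - |indic E i|) := by
    refine Finset.sum_le_sum fun i _ => ?_
    have h0 := hω.1 i
    have h1 := neg_le_abs (ω i - 1)
    have h2 := le_abs_self (ω i - 1)
    by_cases hi₁ : i ∈ E₁
    · have hi := hE₁ hi₁
      simp only [indic, hi, hi₁, Finset.mem_sdiff, not_true_eq_false, and_false, if_true,
        if_false, abs_one]
      linarith
    · by_cases hi : i ∈ E
      · simp only [indic, hi, hi₁, Finset.mem_sdiff, not_false_eq_true, and_true, if_true,
          if_false, abs_one]
        linarith
      · simp [indic, hi, hi₁, abs_of_nonneg h0]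
  have hsplit : ∑ i, (if i ∈ E₁ then -ω i else ω i) =
      -∑ i ∈ E₁, ω i + ∑ i ∈ E₁ᶜ, ω i := by
    rw [← Finset.sum_add_sum_compl E₁, ← Finset.sum_neg_distrib]
    congr 1
    · exact Finset.sum_congr rfl fun i hi => if_pos hi
    · exact Finset.sum_congr rfl fun i hi => if_neg (Finset.mem_compl.1 hi)
  have htwo : ∑ i, (if i ∈ E \ E₁ then (2 : ℝ) else 0) = 2 * (E \ E₁).card := by
    rw [Finset.sum_ite_mem, Finset.univ_inter, Finset.sum_const, nsmul_eq_mul, mul_comm]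
  rw [Finset.sum_sub_distrib, Finset.sum_sub_distrib, hsplit, htwo, hcard] at hpt
  rw [← Finset.sum_add_sum_compl E₁, mul_div_assoc', div_mul_eq_mul_div,
    le_div_iff₀ (by linarith)]
  nlinarith

/-- If `L` collects the largest entries of `|1_E - ω|` and `|L| = |E|`, then the number of
positions of `E` missed by `L` is at most the `ℓ¹` norm of `ω`. -/
lemma card_sdiff_le_sum {n : ℕ} {E L : Finset (Fin n)} {ω : Fin n → ℝ} (hω : ∀ i, 0 ≤ ω i)
    (hLcard : L.card = E.card)
    (hL : ∀ i ∈ L, ∀ i' ∉ L, |indic E i' - ω i'| ≤ |indic E i - ω i|) :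
    ((E \ L).card : ℝ) ≤ ∑ i, ω i := by
  let e : ↥(E \ L) ≃ ↥(L \ E) :=
    Finset.equivOfCardEq (Finset.card_sdiff_comm hLcard.symm)
  have hpair : ∀ i : ↥(E \ L), 1 ≤ ω i + ω (e i) := by
    intro i
    obtain ⟨hiE, hiL⟩ := Finset.mem_sdiff.1 i.2
    obtain ⟨hi'L, hi'E⟩ := Finset.mem_sdiff.1 (e i).2
    have h := hL _ hi'L _ hiL
    simp only [indic, hiE, hi'E, if_true, if_false, zero_sub, abs_neg,
      abs_of_nonneg (hω _)] at h
    linarith [le_abs_self (1 - ω i)]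
  calc ((E \ L).card : ℝ) = ∑ _i : ↥(E \ L), (1 : ℝ) := by simp
    _ ≤ ∑ i : ↥(E \ L), (ω i + ω (e i)) := Finset.sum_le_sum fun i _ => hpair i
    _ = ∑ i ∈ E \ L, ω i + ∑ i ∈ L \ E, ω i := by
      rw [Finset.sum_add_distrib, Equiv.sum_comp e (fun i => ω i), Finset.sum_coe_sort,
        Finset.sum_coe_sort]
    _ = ∑ i ∈ (E \ L) ∪ (L \ E), ω i :=
      (Finset.sum_union disjoint_sdiff_sdiff).symm
    _ ≤ ∑ i, ω i := Finset.sum_le_univ_sum_of_nonneg hω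

/-- Correctness of the reweighted LP decoding algorithm (finite form). -/
theorem reweighted_LP_correct {m n : ℕ} (H : Fin m → Fin n → Bool)
    (E E₁ : Finset (Fin n)) (hE₁ : E₁ ⊆ E) (C : ℝ) (hC : 1 < C)
    (hFCP : FCP H E₁ C)
    (hduals : ∀ A : Finset (Fin n), A.card ≤ E₁.card →
      ∃ τ : Fin n → Fin m → ℝ,
        feasibleDual H (fun i => if i ∈ A then (-1 : ℝ) else 1) τ)
    (hgap : 4 * ((C + 1) / (C - 1)) * ((E.card : ℝ) - E₁.card) ≤ (E₁.card : ℝ))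
    (xp : Fin n → ℝ) (hxp : xp ∈ fundCone H)
    (hobj : ∑ i, |xp i - indic E i| ≤ ∑ i, |indic E i|)
    (L : Finset (Fin n)) (hLcard : L.card = E.card)
    (hL : ∀ i ∈ L, ∀ i' ∉ L, |indic E i' - xp i'| ≤ |indic E i - xp i|)
    (x : Fin n → ℝ) (hx : x ∈ fundPolytope H) (hne : x ≠ 0) :
    -(∑ i ∈ L, |indic E i|) + ∑ i ∈ Lᶜ, |indic E i| <
      -(∑ i ∈ L, |x i - indic E i|) + ∑ i ∈ Lᶜ, |x i - indic E i| := by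
  have hA : ((E \ L) ∪ (L \ E)).card ≤ E₁.card := by
    rw [Finset.card_union_of_disjoint disjoint_sdiff_sdiff,
      ← Finset.card_sdiff_comm hLcard.symm]
    have h1 := card_sdiff_le_sum hxp.1 hLcard hL
    have h2 := hFCP.sum_le hE₁ hC hxp hobj
    have h3 : ((E \ L).card : ℝ) + (E \ L).card ≤ E₁.card := by linarith
    exact_mod_cast h3
  rcases isEmpty_or_nonempty (Fin m) with hm | ⟨⟨j₀⟩⟩
  · -- Without checks the cone is the whole orthant, which forces `E = ∅`.
    have hE₁e : E₁ = ∅ := by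
      by_contra hcon
      obtain ⟨k, hk⟩ := Finset.nonempty_iff_ne_empty.2 hcon
      have h := hFCP (Pi.single k 1)
        ⟨fun i => (Pi.single_nonneg.2 zero_le_one : (0 : Fin n → ℝ) ≤ _) i,
          fun j => hm.elim j⟩
        (by simp)
      have h1 : ∑ i ∈ E₁ᶜ, |(Pi.single k 1 : Fin n → ℝ) i| = 0 :=
        Finset.sum_eq_zero fun i hi => by
          have : i ≠ k := fun hik => Finset.mem_compl.1 hi (hik ▸ hk)
          simp [this]
      rw [h1] at h
      exact absurd h (not_lt.2
        (mul_nonneg (by linarith) (Finset.sum_nonneg fun _ _ => abs_nonneg _)))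
    have hEe : E = ∅ := by
      have hpos : 0 < 4 * ((C + 1) / (C - 1)) :=
        mul_pos four_pos (div_pos (by linarith) (by linarith))
      simp only [hE₁e, Finset.card_empty, Nat.cast_zero, sub_zero] at hgap
      have : (E.card : ℝ) ≤ 0 := by nlinarith
      exact Finset.card_eq_zero.1 (Nat.le_zero.1 (by exact_mod_cast this))
    have hLe : L = ∅ := Finset.card_eq_zero.1 (by rw [hLcard, hEe, Finset.card_empty])
    obtain ⟨k, hk⟩ := Function.ne_iff.1 hne
    have hpos : 0 < ∑ i, |x i| := Finset.sum_pos' (fun _ _ => abs_nonneg _)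
      ⟨k, Finset.mem_univ k, abs_pos.2 hk⟩
    simpa [hEe, hLe, indic] using hpos
  have hloc := fun j => convexHull_localCodewords_subset H j (Set.mem_iInter.1 hx j)
  have hcube := (hloc j₀).1
  have hcone : x ∈ fundCone H := ⟨fun i => (hcube i).1, fun j => (hloc j).2⟩
  obtain ⟨τ, hτ⟩ := hduals _ hA
  have hpos := hτ.sum_pos hcone hne
  rw [← Finset.sum_add_sum_compl L] at hpos
  have hdist : ∀ i, |x i - indic E i| = |indic E i| + if i ∈ E then -x i else x i := by
    intro i
    by_cases hi : i ∈ E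
    · simp only [indic, hi, if_true, abs_one, abs_of_nonpos (sub_nonpos.2 (hcube i).2)]
      ring
    · simp [indic, hi, abs_of_nonneg (hcube i).1]
  have hin : ∑ i ∈ L, (if i ∈ (E \ L) ∪ (L \ E) then (-1 : ℝ) else 1) * x i =
      -∑ i ∈ L, if i ∈ E then -x i else x i := by
    rw [← Finset.sum_neg_distrib]
    refine Finset.sum_congr rfl fun i hi => ?_
    by_cases hiE : i ∈ E <;> simp [hi, hiE]
  have hout : ∑ i ∈ Lᶜ, (if i ∈ (E \ L) ∪ (L \ E) then (-1 : ℝ) else 1) * x i =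
      ∑ i ∈ Lᶜ, if i ∈ E then -x i else x i := by
    refine Finset.sum_congr rfl fun i hi => ?_
    by_cases hiE : i ∈ E <;> simp [Finset.mem_compl.1 hi, hiE]
  rw [hin, hout] at hpos
  simp only [hdist, Finset.sum_add_distrib]
  linarith
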